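/- In the degree-corrected stochastic block model setting (Θ ∈ ℝ^{n×r} a normalized membership matrix, B ∈ ℝ^{r×r} nonnegative with no zero row or column, D₁, D₂ positive diagonal, A = D₁ Θ B Θᵀ D₂, P and Q the row-stochastic normalizations of A and Aᵀ, M = Θᵀ P Θ, N = Θᵀ Q Θ), let 0 ≤ β² < 1, let X ∈ ℝ^{r×r} be the unique solution of X − (β²/2)(M X Mᵀ + N X Nᵀ) = Θᵀ(PPᵀ + QQᵀ)Θ, and let S* ∈ ℝ^{n×n} be the unique solution of S − (β²/2)(P S Pᵀ + Q S Qᵀ) = PPᵀ + QQᵀ. Then S* = Θ X Θᵀ. -/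

import Mathlib

open Matrix

/-- Size of the `p`-th block of the partition of `{1,…,n}` induced by the
block-assignment map `blk`. -/
def blockSize {n r : ℕ} (blk : Fin n → Fin r) (p : Fin r) : ℕ :=
  (Finset.univ.filter fun i => blk i = p).card

/-- Normalized membership matrix `Θ ∈ ℝ^{n×r}`: the `p`-th column is
`(1/√n_p)·χ^(p)`, where `χ^(p)` is the characteristic vector of block `p`
and `n_p` its size. Its columns are orthonormal. -/
noncomputable def Theta {n r : ℕ} (blk : Fin n → Fin r) :
    Matrix (Fin n) (Fin r) ℝ :=
  Matrix.of fun i p =>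
    if blk i = p then (Real.sqrt (blockSize blk p))⁻¹ else 0

/-- Row-stochastic normalization `D⁻¹ A` of a matrix `A`, where `D` is the
diagonal matrix of the row sums of `A`. -/
noncomputable def rowNormalize {n : ℕ} (A : Matrix (Fin n) (Fin n) ℝ) :
    Matrix (Fin n) (Fin n) ℝ :=
  Matrix.diagonal (fun i => (∑ j, A i j)⁻¹) * A

theorem Theta_mul_transpose_apply {n r : ℕ} (blk : Fin n → Fin r) (i k : Fin n) :
    (Theta blk * (Theta blk)ᵀ) i k =
      if blk k = blk i then (blockSize blk (blk i) : ℝ)⁻¹ else 0 := by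
  simp only [Matrix.mul_apply, Matrix.transpose_apply, Theta, Matrix.of_apply, ite_mul, zero_mul,
    Finset.sum_ite_eq, Finset.mem_univ, if_true, mul_ite, mul_zero]
  by_cases h : blk k = blk i
  · rw [if_pos h.symm, if_pos h, h, ← mul_inv, Real.mul_self_sqrt (Nat.cast_nonneg _)]
  · rw [if_neg (Ne.symm h), if_neg h]

/-- `Θ Θᵀ` averages over blocks, so it fixes every matrix whose rows are constant on blocks. -/
theorem Theta_mul_transpose_mul_of_rows_const {n r : ℕ} (blk : Fin n → Fin r)
    (P : Matrix (Fin n) (Fin n) ℝ) (hP : ∀ i k j, blk k = blk i → P k j = P i j) :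
    Theta blk * (Theta blk)ᵀ * P = P := by
  ext i j
  have hpos : (blockSize blk (blk i) : ℝ) ≠ 0 :=
    Nat.cast_ne_zero.mpr (Finset.card_pos.mpr ⟨i, by simp⟩).ne'
  have hsum : ∀ k, (Theta blk * (Theta blk)ᵀ) i k * P k j =
      if blk k = blk i then (blockSize blk (blk i) : ℝ)⁻¹ * P i j else 0 := by
    intro k
    rw [Theta_mul_transpose_apply]
    split_ifs with h
    · rw [hP i k j h]
    · rw [zero_mul]
  rw [Matrix.mul_apply, Finset.sum_congr rfl fun k _ => hsum k, ← Finset.sum_filter,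
    Finset.sum_const, nsmul_eq_mul, ← mul_assoc]
  exact (congrArg (· * P i j) (mul_inv_cancel₀ hpos)).trans (one_mul _)

theorem Theta_nonneg {n r : ℕ} (blk : Fin n → Fin r) (i : Fin n) (p : Fin r) :
    0 ≤ Theta blk i p := by
  simp only [Theta, Matrix.of_apply]
  split_ifs <;> positivity

theorem rowNormalize_apply {n : ℕ} (A : Matrix (Fin n) (Fin n) ℝ) (i j : Fin n) :
    rowNormalize A i j = (∑ j, A i j)⁻¹ * A i j := by
  simp [rowNormalize, Matrix.diagonal_mul]

theorem rowNormalize_nonneg {n : ℕ} {A : Matrix (Fin n) (Fin n) ℝ} (hA : ∀ i j, 0 ≤ A i j)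
    (i j : Fin n) : 0 ≤ rowNormalize A i j := by
  rw [rowNormalize_apply]
  exact mul_nonneg (inv_nonneg.mpr (Finset.sum_nonneg fun k _ => hA i k)) (hA i j)

theorem sum_rowNormalize_le_one {n : ℕ} (A : Matrix (Fin n) (Fin n) ℝ) (i : Fin n) :
    ∑ j, rowNormalize A i j ≤ 1 := by
  simp only [rowNormalize_apply, ← Finset.mul_sum]
  exact inv_mul_le_one

theorem dcsbm_apply {n r : ℕ} (blk : Fin n → Fin r) (B : Matrix (Fin r) (Fin r) ℝ)
    (d₁ d₂ : Fin n → ℝ) (i j : Fin n) :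
    (Matrix.diagonal d₁ * (Theta blk * B * (Theta blk)ᵀ) * Matrix.diagonal d₂) i j =
      d₁ i * (Theta blk * B * (Theta blk)ᵀ) i j * d₂ j := by
  rw [Matrix.mul_diagonal, Matrix.diagonal_mul]

theorem dcsbm_nonneg {n r : ℕ} (blk : Fin n → Fin r) {B : Matrix (Fin r) (Fin r) ℝ}
    (hB : ∀ p q, 0 ≤ B p q) {d₁ d₂ : Fin n → ℝ} (hd₁ : ∀ i, 0 < d₁ i) (hd₂ : ∀ i, 0 < d₂ i)
    (i j : Fin n) :
    0 ≤ (Matrix.diagonal d₁ * (Theta blk * B * (Theta blk)ᵀ) * Matrix.diagonal d₂) i j := by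
  rw [dcsbm_apply]
  refine mul_nonneg (mul_nonneg (hd₁ i).le ?_) (hd₂ j).le
  simp only [Matrix.mul_apply, Matrix.transpose_apply]
  exact Finset.sum_nonneg fun q _ => mul_nonneg
    (Finset.sum_nonneg fun p _ => mul_nonneg (Theta_nonneg blk i p) (hB p q)) (Theta_nonneg blk j q)

/-- Normalizing the rows removes the left degree correction, so the rows become constant on
blocks. -/
theorem Theta_mul_transpose_mul_rowNormalize_dcsbm {n r : ℕ} (blk : Fin n → Fin r)
    (B : Matrix (Fin r) (Fin r) ℝ) {d₁ : Fin n → ℝ} (hd₁ : ∀ i, 0 < d₁ i) (d₂ : Fin n → ℝ) :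
    Theta blk * (Theta blk)ᵀ * rowNormalize
        (Matrix.diagonal d₁ * (Theta blk * B * (Theta blk)ᵀ) * Matrix.diagonal d₂) =
      rowNormalize (Matrix.diagonal d₁ * (Theta blk * B * (Theta blk)ᵀ) * Matrix.diagonal d₂) := by
  set C := Theta blk * B * (Theta blk)ᵀ with hC
  have key : ∀ i j, rowNormalize (Matrix.diagonal d₁ * C * Matrix.diagonal d₂) i j =
      (∑ j, C i j * d₂ j)⁻¹ * (C i j * d₂ j) := by
    intro i j
    rw [rowNormalize_apply]
    simp only [hC, dcsbm_apply, mul_assoc (d₁ i), ← Finset.mul_sum]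
    rw [mul_inv, mul_mul_mul_comm, inv_mul_cancel₀ (hd₁ i).ne', one_mul]
  refine Theta_mul_transpose_mul_of_rows_const blk _ fun i k j h => ?_
  have hrow : ∀ j, C k j = C i j := fun j => by
    simp only [hC, Matrix.mul_apply, Theta, Matrix.of_apply, h]
  simp only [key, hrow]

theorem abs_mul_apply_le_of_rowSubstochastic {n : ℕ} {P E : Matrix (Fin n) (Fin n) ℝ}
    (hP : ∀ i j, 0 ≤ P i j) (hsum : ∀ i, ∑ j, P i j ≤ 1) {K : ℝ} (hK : 0 ≤ K)
    (hE : ∀ i j, |E i j| ≤ K) (i j : Fin n) : |(P * E) i j| ≤ K := by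
  rw [Matrix.mul_apply]
  calc |∑ k, P i k * E k j| ≤ ∑ k, |P i k * E k j| := Finset.abs_sum_le_sum_abs _ _
    _ ≤ ∑ k, P i k * K := Finset.sum_le_sum fun k _ => by
        rw [abs_mul, abs_of_nonneg (hP i k)]
        exact mul_le_mul_of_nonneg_left (hE k j) (hP i k)
    _ = (∑ k, P i k) * K := (Finset.sum_mul _ _ _).symm
    _ ≤ K := mul_le_of_le_one_left hK (hsum i)

theorem abs_mul_mul_transpose_apply_le_of_rowSubstochastic {n : ℕ}
    {P E : Matrix (Fin n) (Fin n) ℝ} (hP : ∀ i j, 0 ≤ P i j) (hsum : ∀ i, ∑ j, P i j ≤ 1)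
    {K : ℝ} (hK : 0 ≤ K) (hE : ∀ i j, |E i j| ≤ K) (i j : Fin n) :
    |(P * E * Pᵀ) i j| ≤ K := by
  have h := abs_mul_apply_le_of_rowSubstochastic hP hsum (E := (P * E)ᵀ) hK
    (fun a b => abs_mul_apply_le_of_rowSubstochastic hP hsum hK hE b a) j i
  rwa [← Matrix.transpose_apply (P * (P * E)ᵀ), Matrix.transpose_mul,
    Matrix.transpose_transpose] at h

/-- The homogeneous equation `E = (β²/2)(P E Pᵀ + Q E Qᵀ)` has only the trivial solution. -/
theorem eq_zero_of_eq_smul_mul_mul_transpose {n : ℕ} {P Q E : Matrix (Fin n) (Fin n) ℝ}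
    (hP : ∀ i j, 0 ≤ P i j) (hPsum : ∀ i, ∑ j, P i j ≤ 1)
    (hQ : ∀ i j, 0 ≤ Q i j) (hQsum : ∀ i, ∑ j, Q i j ≤ 1)
    {β : ℝ} (hβ : β ^ 2 < 1) (hE : E = (β ^ 2 / 2) • (P * E * Pᵀ + Q * E * Qᵀ)) : E = 0 := by
  ext i j
  have : Nonempty (Fin n × Fin n) := ⟨(i, j)⟩
  obtain ⟨⟨a, b⟩, hab⟩ := Finite.exists_max fun x : Fin n × Fin n => |E x.1 x.2|
  have hmax : ∀ i j, |E i j| ≤ |E a b| := fun i j => hab (i, j)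
  have h₁ := abs_mul_mul_transpose_apply_le_of_rowSubstochastic hP hPsum (abs_nonneg _) hmax a b
  have h₂ := abs_mul_mul_transpose_apply_le_of_rowSubstochastic hQ hQsum (abs_nonneg _) hmax a b
  have h₃ : |E a b| = β ^ 2 / 2 * |(P * E * Pᵀ) a b + (Q * E * Qᵀ) a b| := by
    conv_lhs => rw [hE]
    rw [Matrix.smul_apply, smul_eq_mul, abs_mul, abs_of_nonneg (by positivity), Matrix.add_apply]
  have h₄ : |E a b| ≤ β ^ 2 * |E a b| := by
    have := mul_le_mul_of_nonneg_left ((abs_add_le _ _).trans (add_le_add h₁ h₂))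
      (by positivity : 0 ≤ β ^ 2 / 2)
    linarith
  have h₅ : |E a b| ≤ 0 := by nlinarith [abs_nonneg (E a b)]
  exact abs_nonpos_iff.mp ((hmax i j).trans h₅)

/-- If `P` and `Q` have range in that of a projection `T Tᵀ`, a solution of the compressed
equation lifts to a solution of the full one. -/
theorem lift_sub_smul_eq {n r : ℕ} {T : Matrix (Fin n) (Fin r) ℝ}
    {P Q : Matrix (Fin n) (Fin n) ℝ} (hP : T * Tᵀ * P = P) (hQ : T * Tᵀ * Q = Q) {c : ℝ}
    {X : Matrix (Fin r) (Fin r) ℝ}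
    (hX : X - c • ((Tᵀ * P * T) * X * (Tᵀ * P * T)ᵀ + (Tᵀ * Q * T) * X * (Tᵀ * Q * T)ᵀ) =
      Tᵀ * (P * Pᵀ + Q * Qᵀ) * T) :
    T * X * Tᵀ - c • (P * (T * X * Tᵀ) * Pᵀ + Q * (T * X * Tᵀ) * Qᵀ) = P * Pᵀ + Q * Qᵀ := by
  have hcomp : ∀ R : Matrix (Fin n) (Fin n) ℝ, T * Tᵀ * R = R →
      R * (T * X * Tᵀ) * Rᵀ = T * ((Tᵀ * R * T) * X * (Tᵀ * R * T)ᵀ) * Tᵀ := by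
    intro R hR
    calc R * (T * X * Tᵀ) * Rᵀ = (T * Tᵀ * R) * (T * X * Tᵀ) * (T * Tᵀ * R)ᵀ := by rw [hR]
      _ = _ := by simp only [Matrix.transpose_mul, Matrix.transpose_transpose, Matrix.mul_assoc]
  have hproj : ∀ R : Matrix (Fin n) (Fin n) ℝ, T * Tᵀ * R = R →
      T * (Tᵀ * (R * Rᵀ) * T) * Tᵀ = R * Rᵀ := by
    intro R hR
    calc T * (Tᵀ * (R * Rᵀ) * T) * Tᵀ = (T * Tᵀ * R) * (T * Tᵀ * R)ᵀ := by
          simp only [Matrix.transpose_mul, Matrix.transpose_transpose, Matrix.mul_assoc]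
      _ = _ := by rw [hR]
  have h := congrArg (fun Y => T * Y * Tᵀ) hX
  simp only [Matrix.mul_sub, Matrix.sub_mul, Matrix.mul_smul, Matrix.smul_mul, Matrix.mul_add,
    Matrix.add_mul] at h
  rwa [← hcomp P hP, ← hcomp Q hQ, hproj P hP, hproj Q hQ] at h

/-- Theorem: in the degree-corrected SBM setting with `0 ≤ β² < 1`, if `X` is
the solution of the reduced equation
`X − (β²/2)(M X Mᵀ + N X Nᵀ) = Θᵀ(PPᵀ + QQᵀ)Θ` and `S*` is the solution of
`S − (β²/2)(P S Pᵀ + Q S Qᵀ) = PPᵀ + QQᵀ`, then `S* = Θ X Θᵀ`. -/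
theorem Sstar_eq_Theta_X_ThetaT {n r : ℕ}
    (blk : Fin n → Fin r) (hblk : Function.Surjective blk)
    (B : Matrix (Fin r) (Fin r) ℝ)
    (hBnn : ∀ p q, 0 ≤ B p q)
    (hBrow : ∀ p, ∃ q, 0 < B p q) (hBcol : ∀ q, ∃ p, 0 < B p q)
    (d₁ d₂ : Fin n → ℝ) (hd₁ : ∀ i, 0 < d₁ i) (hd₂ : ∀ i, 0 < d₂ i)
    (A P Q : Matrix (Fin n) (Fin n) ℝ)
    (hA : A = Matrix.diagonal d₁ * (Theta blk * B * (Theta blk)ᵀ) *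
      Matrix.diagonal d₂)
    (hP : P = rowNormalize A) (hQ : Q = rowNormalize Aᵀ)
    (M N : Matrix (Fin r) (Fin r) ℝ)
    (hM : M = (Theta blk)ᵀ * P * Theta blk)
    (hN : N = (Theta blk)ᵀ * Q * Theta blk)
    (β : ℝ) (hβ : β ^ 2 < 1)
    (X : Matrix (Fin r) (Fin r) ℝ)
    (hX : X - (β ^ 2 / 2) • (M * X * Mᵀ + N * X * Nᵀ) =
      (Theta blk)ᵀ * (P * Pᵀ + Q * Qᵀ) * Theta blk)
    (Sstar : Matrix (Fin n) (Fin n) ℝ)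
    (hS : Sstar - (β ^ 2 / 2) • (P * Sstar * Pᵀ + Q * Sstar * Qᵀ) =
      P * Pᵀ + Q * Qᵀ) :
    Sstar = Theta blk * X * (Theta blk)ᵀ := by
  have hAt : Aᵀ = Matrix.diagonal d₂ * (Theta blk * Bᵀ * (Theta blk)ᵀ) * Matrix.diagonal d₁ := by
    simp only [hA, Matrix.transpose_mul, Matrix.diagonal_transpose, Matrix.transpose_transpose,
      Matrix.mul_assoc]
  have hAnn : ∀ i j, 0 ≤ A i j := hA ▸ dcsbm_nonneg blk hBnn hd₁ hd₂
  have hPfix : Theta blk * (Theta blk)ᵀ * P = P := by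
    rw [hP, hA]
    exact Theta_mul_transpose_mul_rowNormalize_dcsbm blk B hd₁ d₂
  have hQfix : Theta blk * (Theta blk)ᵀ * Q = Q := by
    rw [hQ, hAt]
    exact Theta_mul_transpose_mul_rowNormalize_dcsbm blk Bᵀ hd₂ d₁
  rw [hM, hN] at hX
  have hT := lift_sub_smul_eq hPfix hQfix hX
  rw [← sub_eq_zero]
  refine eq_zero_of_eq_smul_mul_mul_transpose (P := P) (Q := Q)
    (hP ▸ rowNormalize_nonneg hAnn) (hP ▸ sum_rowNormalize_le_one A)
    (hQ ▸ rowNormalize_nonneg fun i j => hAnn j i) (hQ ▸ sum_rowNormalize_le_one Aᵀ) hβ ?_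
  have h := sub_eq_zero.mpr (hS.trans hT.symm)
  rw [← sub_eq_zero, ← h]
  simp only [Matrix.mul_sub, Matrix.sub_mul, smul_add, smul_sub]
  abel
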